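/- Let (Z, d) be a metric space, S_l a sequence of nonempty compact subsets of a fixed compact set K, gamma in (0,1), and suppose S_{l+1} is contained in the closed 4*gamma^l-neighborhood of S_l for every l. Then S_l converges in the Hausdorff distance to a nonempty compact set S_0, and S_0 is contained in the closed 8*gamma^l/(1-gamma)-neighborhood of S_l for every l. Moreover, if V_l >= 0 satisfy Vol(closed 4*gamma^l-neighborhood of S_l) <= A gamma^{l(N-j)} for a Borel measure Vol with Vol(B(x,r)) >= c r^N for r in (0,1), then the j-dimensional Hausdorff measure of S_0 is at most C(A, c, N, j, gamma). -/

import Mathlib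

open Set Metric MeasureTheory Filter

open scoped ENNReal NNReal

/-- A compact set contains a finite `r`-separated `r`-net. -/
lemma IsCompact.exists_finset_separated_net {Z : Type*} [MetricSpace Z] {S : Set Z}
    (hS : IsCompact S) {r : ℝ} (hr : 0 < r) :
    ∃ t : Finset Z, (t : Set Z) ⊆ S ∧ (∀ x ∈ t, ∀ y ∈ t, x ≠ y → r < dist x y) ∧
      ∀ x ∈ S, ∃ y ∈ t, dist x y ≤ r := by
  lift r to ℝ≥0 using hr.le
  have hr' : r / 2 ≠ 0 := by
    have : (0 : ℝ≥0) < r := by exact_mod_cast hr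
    positivity
  have hfin : packingNumber r S ≠ ⊤ := by
    obtain ⟨N, -, hNfin, hN⟩ := exists_finite_isCover_of_isCompact hr' hS
    have h := packingNumber_two_mul_le_externalCoveringNumber (r / 2) S
    rw [mul_div_cancel₀ r two_ne_zero] at h
    exact ((h.trans hN.externalCoveringNumber_le_encard).trans_lt hNfin.encard_lt_top).ne
  have hmfin : (maximalSeparatedSet r S).Finite := by
    rw [← encard_ne_top_iff, encard_maximalSeparatedSet hfin]
    exact hfin
  refine ⟨hmfin.toFinset, by simpa using maximalSeparatedSet_subset, ?_, ?_⟩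
  · intro x hx y hy hxy
    have h : (r : ℝ≥0∞) < edist x y := isSeparated_maximalSeparatedSet (hmfin.mem_toFinset.1 hx)
      (hmfin.mem_toFinset.1 hy) hxy
    rw [edist_nndist, ENNReal.coe_lt_coe] at h
    exact_mod_cast h
  · intro x hx
    have h := (isCover_maximalSeparatedSet hfin).subset_iUnion_closedBall hx
    simpa using h

/-- If the `r / 2`-balls around an `r`-separated finite set lie in `U` and have measure at least `b`,
then the cardinality of the set times `b` is at most `μ U`. -/
lemma card_mul_le_measure_of_separated {Z : Type*} [MetricSpace Z] [MeasurableSpace Z]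
    [BorelSpace Z] (μ : Measure Z) {t : Finset Z} {r : ℝ} {b : ℝ≥0∞} {U : Set Z}
    (ht : ∀ x ∈ t, ∀ y ∈ t, x ≠ y → r < dist x y)
    (hb : ∀ x ∈ t, b ≤ μ (ball x (r / 2))) (hU : ∀ x ∈ t, ball x (r / 2) ⊆ U) :
    (t.card : ℝ≥0∞) * b ≤ μ U := by
  have hd : PairwiseDisjoint (t : Set Z) fun x => ball x (r / 2) := by
    intro x hx y hy hxy
    exact ball_disjoint_ball (by linarith [ht x hx y hy hxy])
  calc (t.card : ℝ≥0∞) * b = ∑ _x ∈ t, b := by simp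
    _ ≤ ∑ x ∈ t, μ (ball x (r / 2)) := Finset.sum_le_sum hb
    _ = μ (⋃ x ∈ t, ball x (r / 2)) :=
      (measure_biUnion_finset hd fun _ _ => measurableSet_ball).symm
    _ ≤ μ U := measure_mono (iUnion₂_subset hU)

/-- If for scales `δ l → 0` the set `E` is covered by `n l` closed balls of radius `R * δ l` with
`n l * δ l ^ j ≤ B`, then `μH[j] E ≤ B * (2 * R) ^ j`. -/
lemma hausdorffMeasure_le_of_closedBall_covers {Z : Type*} [MetricSpace Z] [MeasurableSpace Z]
    [BorelSpace Z] {E : Set Z} {j B R : ℝ} (hj : 0 ≤ j) (hR : 0 ≤ R) {δ : ℕ → ℝ}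
    (hδ : ∀ l, 0 ≤ δ l) (hδ0 : Tendsto δ atTop (nhds 0)) (t : ℕ → Finset Z)
    (hcov : ∀ l, E ⊆ ⋃ x ∈ t l, closedBall x (R * δ l))
    (hcard : ∀ l, ((t l).card : ℝ) * δ l ^ j ≤ B) :
    μH[j] E ≤ ENNReal.ofReal (B * (2 * R) ^ j) := by
  have hdiam : ∀ l (x : Z), ediam (closedBall x (R * δ l)) ≤ ENNReal.ofReal (2 * R * δ l) := by
    intro l x
    rw [← closedEBall_ofReal (mul_nonneg hR (hδ l)), mul_assoc, ENNReal.ofReal_mul zero_le_two,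
      ENNReal.ofReal_ofNat]
    exact ediam_closedEBall_le
  have hlim : Tendsto (fun l => ENNReal.ofReal (2 * R * δ l)) atTop (nhds 0) := by
    simpa using ENNReal.tendsto_ofReal (hδ0.const_mul (2 * R))
  refine (Measure.hausdorffMeasure_le_liminf_sum (ι := fun l => t l) j E _ hlim
    (fun l x => closedBall (x : Z) (R * δ l)) (.of_forall fun l x => hdiam l x)
    (.of_forall fun l => (hcov l).trans (by simp [iUnion_subtype]))).trans ?_
  refine liminf_le_of_le (by isBoundedDefault) fun b hb => ?_
  obtain ⟨l, hl⟩ := hb.exists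
  refine hl.trans ?_
  have h2 : 0 ≤ 2 * R * δ l := mul_nonneg (by linarith) (hδ l)
  calc ∑ x : t l, ediam (closedBall (x : Z) (R * δ l)) ^ j
      ≤ ∑ _x : t l, ENNReal.ofReal ((2 * R * δ l) ^ j) := by
        refine Finset.sum_le_sum fun x _ => ?_
        rw [← ENNReal.ofReal_rpow_of_nonneg h2 hj]
        exact ENNReal.rpow_le_rpow (hdiam l x) hj
    _ = ENNReal.ofReal ((t l).card * (2 * R * δ l) ^ j) := by
        rw [ENNReal.ofReal_mul (Nat.cast_nonneg _)]
        simp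
    _ ≤ ENNReal.ofReal (B * (2 * R) ^ j) := by
        refine ENNReal.ofReal_le_ofReal ?_
        rw [Real.mul_rpow (by linarith) (hδ l)]
        have := mul_le_mul_of_nonneg_right (hcard l)
          (Real.rpow_nonneg (by linarith : 0 ≤ 2 * R) j)
        linarith

section Limit

variable {Z : Type*} [MetricSpace Z] {K : Set Z} {S : ℕ → Set Z} {γ : ℝ}

/-- The intersection of the closed `4γ^l/(1-γ)`-neighborhoods, within `K`, of the sets `S l`. -/
def centersLimit (γ : ℝ) (K : Set Z) (S : ℕ → Set Z) : Set Z :=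
  ⋂ l, K ∩ cthickening (4 * γ ^ l / (1 - γ)) (S l)

lemma antitone_inter_cthickening (hγ : γ ∈ Ioo (0 : ℝ) 1)
    (h : ∀ l, S (l + 1) ⊆ cthickening (4 * γ ^ l) (S l)) :
    Antitone fun l => K ∩ cthickening (4 * γ ^ l / (1 - γ)) (S l) := by
  have h1 : 0 < 1 - γ := sub_pos.2 hγ.2
  have h0 := hγ.1
  refine antitone_nat_of_succ_le fun l => inter_subset_inter_right K ?_
  refine (cthickening_subset_of_subset _ (h l)).trans <|
    (cthickening_cthickening_subset (by positivity) (by positivity) _).trans ?_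
  refine cthickening_mono (le_of_eq ?_) _
  field_simp
  ring

lemma isCompact_inter_cthickening (hK : IsCompact K) (r : ℝ) (s : Set Z) :
    IsCompact (K ∩ cthickening r s) :=
  hK.inter_right isClosed_cthickening

lemma centersLimit_subset_cthickening (l : ℕ) :
    centersLimit γ K S ⊆ cthickening (4 * γ ^ l / (1 - γ)) (S l) :=
  (iInter_subset _ l).trans inter_subset_right

lemma isCompact_centersLimit (hK : IsCompact K) : IsCompact (centersLimit γ K S) :=
  hK.of_isClosed_subset
    (isClosed_iInter fun _ => (isCompact_inter_cthickening hK _ _).isClosed)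
    ((iInter_subset _ 0).trans inter_subset_left)

lemma subset_inter_cthickening (hSK : ∀ l, S l ⊆ K) (l : ℕ) (r : ℝ) :
    S l ⊆ K ∩ cthickening r (S l) :=
  subset_inter (hSK l) (self_subset_cthickening _)

lemma centersLimit_nonempty (hγ : γ ∈ Ioo (0 : ℝ) 1) (hK : IsCompact K)
    (hne : ∀ l, (S l).Nonempty) (hSK : ∀ l, S l ⊆ K)
    (h : ∀ l, S (l + 1) ⊆ cthickening (4 * γ ^ l) (S l)) :
    (centersLimit γ K S).Nonempty :=
  IsCompact.nonempty_iInter_of_sequence_nonempty_isCompact_isClosed _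
    (fun l => antitone_inter_cthickening hγ h l.le_succ)
    (fun l => (hne l).mono (subset_inter_cthickening hSK l _))
    (isCompact_inter_cthickening hK _ _)
    (fun _ => (isCompact_inter_cthickening hK _ _).isClosed)

lemma tendsto_hausdorffDist_centersLimit (hγ : γ ∈ Ioo (0 : ℝ) 1) (hK : IsCompact K)
    (hne : ∀ l, (S l).Nonempty) (hSK : ∀ l, S l ⊆ K)
    (h : ∀ l, S (l + 1) ⊆ cthickening (4 * γ ^ l) (S l)) :
    Tendsto (fun l => hausdorffDist (S l) (centersLimit γ K S)) atTop (nhds 0) := by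
  have hanti := antitone_inter_cthickening (K := K) hγ h
  rw [Metric.tendsto_atTop]
  intro ε hε
  obtain ⟨m, hm⟩ := exists_subset_nhds_of_isCompact hanti.directed_ge
    (fun _ => isCompact_inter_cthickening hK _ _) (U := thickening (ε / 2) (centersLimit γ K S))
    fun x hx => isOpen_thickening.mem_nhds (self_subset_thickening (half_pos hε) _ hx)
  have hrad : Tendsto (fun l => 4 * γ ^ l / (1 - γ)) atTop (nhds 0) := by
    simpa using ((tendsto_pow_atTop_nhds_zero_of_lt_one hγ.1.le hγ.2).const_mul 4).div_const (1 - γ)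
  obtain ⟨k, hk⟩ := eventually_atTop.1 (hrad.eventually_le_const (half_pos hε))
  refine ⟨max m k, fun l hl => ?_⟩
  rw [Real.dist_eq, sub_zero, abs_of_nonneg hausdorffDist_nonneg]
  refine (hausdorffDist_le_of_infDist (half_pos hε).le (fun x hx => ?_) fun x hx => ?_).trans_lt
    (half_lt_self hε)
  · have hx' := hm (hanti ((le_max_left m k).trans hl) (subset_inter_cthickening hSK l _ hx))
    exact ((mem_thickening_iff_infDist_lt (centersLimit_nonempty hγ hK hne hSK h)).1 hx').le
  · have hx' := cthickening_mono (hk l ((le_max_right m k).trans hl)) _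
      (centersLimit_subset_cthickening l hx)
    rwa [mem_cthickening_iff, ENNReal.le_ofReal_iff_toReal_le (infEDist_ne_top (hne l))
      (half_pos hε).le] at hx'

end Limit

/-- Hausdorff limit of the neck centers: if `S_l` are nonempty compact subsets of a
compact set `K` with `S_{l+1}` contained in the closed `4γ^l`-neighborhood of `S_l`
(`γ ∈ (0,1)`), then `S_l` converges in the Hausdorff distance to a nonempty compact set
`S₀` contained in the closed `8γ^l/(1-γ)`-neighborhood of each `S_l`; moreover, if a
Borel measure with `N`-dimensional lower volume bound `c r^N` on balls gives the closed
`4γ^l`-neighborhood of `S_l` measure at most `A γ^{l(N-j)}`, then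
`H^j(S₀) ≤ C'(A,c,N,j,γ)`. -/
theorem hausdorff_limit_of_centers (γ A c N j : ℝ) (hγ : γ ∈ Ioo (0:ℝ) 1)
    (hA : 0 < A) (hc : 0 < c) (hN : 1 ≤ N) (hj0 : 0 ≤ j) (hjN : j ≤ N) :
    ∃ C' : ℝ, 0 < C' ∧
      ∀ (Z : Type) [MetricSpace Z] [MeasurableSpace Z] [BorelSpace Z]
        (K : Set Z) (S : ℕ → Set Z),
        IsCompact K → (∀ l, (S l).Nonempty) → (∀ l, IsCompact (S l)) →
        (∀ l, S l ⊆ K) →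
        (∀ l, S (l+1) ⊆ cthickening (4 * γ ^ l) (S l)) →
        ∃ S₀ : Set Z, IsCompact S₀ ∧ S₀.Nonempty ∧
          Tendsto (fun l => hausdorffDist (S l) S₀) atTop (nhds 0) ∧
          (∀ l, S₀ ⊆ cthickening (8 * γ ^ l / (1 - γ)) (S l)) ∧
          ∀ (μ : Measure Z),
            (∀ (x : Z), ∀ r ∈ Ioo (0:ℝ) 1,
              ENNReal.ofReal (c * r ^ N) ≤ μ (ball x r)) →
            (∀ l, μ (cthickening (4 * γ ^ l) (S l)) ≤
              ENNReal.ofReal (A * γ ^ ((l : ℝ) * (N - j)))) →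
            μH[j] S₀ ≤ ENNReal.ofReal C' := by
  have h0 : 0 < γ := hγ.1
  have h1 : 0 < 1 - γ := sub_pos.2 hγ.2
  refine ⟨A / c * 2 ^ N * (2 * (9 / (1 - γ))) ^ j, by positivity, ?_⟩
  intro Z _ _ _ K S hK hne hS hSK h
  have hsub : ∀ l, centersLimit γ K S ⊆ cthickening (8 * γ ^ l / (1 - γ)) (S l) := fun l =>
    (centersLimit_subset_cthickening l).trans (cthickening_mono (by gcongr; norm_num) _)
  refine ⟨centersLimit γ K S, isCompact_centersLimit hK, centersLimit_nonempty hγ hK hne hSK h,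
    tendsto_hausdorffDist_centersLimit hγ hK hne hSK h, hsub, fun μ hlow hup => ?_⟩
  have hpos : ∀ l, 0 < γ ^ l := fun l => pow_pos h0 l
  choose t htS htsep htnet using fun l => (hS l).exists_finset_separated_net (hpos l)
  refine hausdorffMeasure_le_of_closedBall_covers hj0 (by positivity) (fun l => (hpos l).le)
    (tendsto_pow_atTop_nhds_zero_of_lt_one h0.le hγ.2) t (fun l x hx => ?_) fun l => ?_
  · have hx' := hsub l hx
    rw [(hS l).cthickening_eq_biUnion_closedBall (by positivity)] at hx'
    obtain ⟨y, hy, hxy⟩ := mem_iUnion₂.1 hx'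
    obtain ⟨z, hz, hyz⟩ := htnet l y hy
    refine mem_iUnion₂.2 ⟨z, hz, mem_closedBall.2 ?_⟩
    have hle : γ ^ l ≤ γ ^ l / (1 - γ) := le_div_self (hpos l).le h1 (by linarith)
    calc dist x z ≤ dist x y + dist y z := dist_triangle _ _ _
      _ ≤ 8 * γ ^ l / (1 - γ) + γ ^ l / (1 - γ) := add_le_add hxy (hyz.trans hle)
      _ = 9 / (1 - γ) * γ ^ l := by ring
  · have hl1 : γ ^ l ≤ 1 := pow_le_one₀ h0.le hγ.2.le
    have hcard := (card_mul_le_measure_of_separated μ (U := cthickening (4 * γ ^ l) (S l))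
      (htsep l) (fun x _ => hlow x (γ ^ l / 2) ⟨half_pos (hpos l), by linarith⟩)
      fun x hx => (ball_subset_closedBall.trans
        (closedBall_subset_closedBall (by linarith [hpos l]))).trans
          (closedBall_subset_cthickening (htS l hx) _)).trans (hup l)
    rw [← ENNReal.ofReal_natCast, ← ENNReal.ofReal_mul (Nat.cast_nonneg _),
      Real.rpow_natCast_mul h0.le,
      ENNReal.ofReal_le_ofReal_iff (mul_nonneg hA.le (Real.rpow_nonneg (hpos l).le _)),
      Real.rpow_sub (hpos l), Real.div_rpow (hpos l).le zero_le_two] at hcard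
    have hN' : 0 < (γ ^ l) ^ N := Real.rpow_pos_of_pos (hpos l) N
    have hj' : 0 < (γ ^ l) ^ j := Real.rpow_pos_of_pos (hpos l) j
    have h2 : (0 : ℝ) < 2 ^ N := by positivity
    generalize (γ ^ l) ^ N = u at *
    generalize (γ ^ l) ^ j = v at *
    generalize (2 : ℝ) ^ N = w at *
    field_simp at hcard ⊢
    linarith
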